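/- Let H be a connected graded Hopf algebra with a natural growth operator ⊤, and let Φ_{(u_i)} be the coalgebra endomorphism of H associated to a family (u_i)_{i ∈ ℕ} of linear maps u_i: P(H)^{⊗i} → P(H). Then Φ_{(u_i)} is bijective if and only if u_1: P(H) → P(H) is bijective. -/

import Mathlib

open TensorProduct

section NaturalGrowthPrelude

variable (K H : Type*) [CommRing K] [Ring H] [HopfAlgebra K H]

/-- The reduced coproduct `Δ̂(x) = Δ(x) − x ⊗ 1 − 1 ⊗ x`. -/
noncomputable def reducedComul : H →ₗ[K] H ⊗[K] H :=
  Coalgebra.comul - (TensorProduct.mk K H H).flip 1 - TensorProduct.mk K H H 1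

variable {K H}

/-- `⊤` is a natural growth operator: `Δ̂(x ⊤ y) = x ⊗ y + x⁽¹⁾ ⊗ (x⁽²⁾ ⊤ y)`
for all `x` and all primitive `y` (i.e. `Δ̂(y) = 0`). -/
def IsNaturalGrowth (top : H →ₗ[K] H →ₗ[K] H) : Prop :=
  ∀ x y : H, reducedComul K H y = 0 →
    reducedComul K H (top x y) =
      x ⊗ₜ[K] y +
        (TensorProduct.map LinearMap.id (top.flip y)) (reducedComul K H x)

/-- A connected grading on a Hopf algebra, compatible with product and coproduct. -/
structure HopfGrading : Type _ where
  grade : ℕ → Submodule K H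
  internal : DirectSum.IsInternal grade
  connected : grade 0 = (K ∙ (1 : H))
  mul_mem : ∀ {i j : ℕ} {x y : H}, x ∈ grade i → y ∈ grade j → x * y ∈ grade (i + j)
  comul_mem : ∀ (n : ℕ), ∀ x ∈ grade n,
    Coalgebra.comul (R := K) x ∈
      ⨆ p : {p : ℕ × ℕ // p.1 + p.2 = n},
        LinearMap.range
          (TensorProduct.map (grade p.1.1).subtype (grade p.1.2).subtype)

/-- `nestAux top p a k = p_{a+k} ⊤ p_{a+k-1} ⊤ ⋯ ⊤ p_a` (left-nested:
`(p_{a+k} ⊤ ⋯ ⊤ p_{a+1}) ⊤ p_a`). -/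
noncomputable def nestAux (top : H →ₗ[K] H →ₗ[K] H) (p : ℕ → H) : ℕ → ℕ → H
  | a, 0 => p a
  | a, k + 1 => top (nestAux top p (a + 1) k) (p a)

/-- `nest top p a b = p_b ⊤ p_{b-1} ⊤ ⋯ ⊤ p_a` (for `a ≤ b`),
i.e. the iterated natural growth product `(p_b ⊤ ⋯ ⊤ p_{a+1}) ⊤ p_a`. -/
noncomputable def nest (top : H →ₗ[K] H →ₗ[K] H) (p : ℕ → H) (a b : ℕ) : H :=
  nestAux top p a (b - a)

end NaturalGrowthPrelude

/-!
STATEMENT 13: Let H be a connected graded Hopf algebra with a natural growth operator ⊤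
and Φ_{(u_i)} the coalgebra endomorphism associated to a family
u_i : P(H)^{⊗i} → P(H).  Then Φ_{(u_i)} is bijective if and only if
u_1 : P(H) → P(H) is bijective.
-/

universe u

section TensorPowers

variable (K : Type u) [Field K] (H : Type u) [Ring H] [HopfAlgebra K H]

/-- The submodule of primitive elements `P(H) = {x | Δ̂(x) = 0}`. -/
noncomputable def Prim : Submodule K H := LinearMap.ker (reducedComul K H)

/-- Left-nested tensor powers of the space of primitives:
`PTP n = P(H)^{⊗(n+1)}`. -/
noncomputable def PTP : ℕ → ModuleCat K
  | 0 => ModuleCat.of K (Prim K H)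
  | n + 1 => ModuleCat.of K ((PTP n : Type u) ⊗[K] (Prim K H))

variable {K H}

/-- `Fmap top n : P(H)^{⊗(n+1)} → H` sends the (left-nested) pure tensor
`p_{n+1} ⊗ ⋯ ⊗ p_1` to `p_{n+1} ⊤ ⋯ ⊤ p_1`; i.e. `Fmap top (i-1) = F_i`. -/
noncomputable def Fmap (top : H →ₗ[K] H →ₗ[K] H) :
    (n : ℕ) → (PTP K H n : Type u) →ₗ[K] H
  | 0 => (Prim K H).subtype
  | n + 1 => TensorProduct.lift ((top ∘ₗ Fmap top n).compl₂ (Prim K H).subtype)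

/-- `segT p a m = p_{a+m} ⊗ ⋯ ⊗ p_a ∈ P(H)^{⊗(m+1)}` (left-nested pure tensor of
a consecutive segment of the family `p`). -/
noncomputable def segT (p : ℕ → Prim K H) : ℕ → (m : ℕ) → (PTP K H m : Type u)
  | a, 0 => p a
  | a, m + 1 => (segT p (a + 1) m) ⊗ₜ[K] (p a)

/-- Left-nested iterated product: `nestList top x [y₁,…,y_k] = ((x ⊤ y₁) ⊤ ⋯) ⊤ y_k`. -/
noncomputable def nestList (top : H →ₗ[K] H →ₗ[K] H) : H → List H → H
  | x, [] => x
  | x, y :: l => nestList top (top x y) l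

/-- Left-nested iterated product of a list, `nestList' top [q₁,…,q_k] = q₁ ⊤ ⋯ ⊤ q_k`. -/
noncomputable def nestList' (top : H →ₗ[K] H →ₗ[K] H) : List H → H
  | [] => 0
  | x :: l => nestList top x l

/-- The defining equations of the coalgebra endomorphism `Φ_{(u_i)}` attached to a
family of maps `us m : P(H)^{⊗(m+1)} → P(H)` (so `us (i-1) = u_i`):
`Φ(1) = 1` and
`Φ(p_n ⊤ ⋯ ⊤ p_1) = Σ_{k=1}^{n} Σ_{a_1+⋯+a_k = n} F_k((u_{a_1} ⊗ ⋯ ⊗ u_{a_k})(F_n⁻¹(p_n ⊤ ⋯ ⊤ p_1)))`,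
where the inner sum is over all compositions of `n` and `(u_{a_1} ⊗ ⋯ ⊗ u_{a_k})`
acts on consecutive segments of `p_n ⊗ ⋯ ⊗ p_1 = F_n⁻¹(p_n ⊤ ⋯ ⊤ p_1)`. -/
def PhiEqns (top : H →ₗ[K] H →ₗ[K] H)
    (us : (m : ℕ) → (PTP K H m : Type u) →ₗ[K] Prim K H)
    (Φ : H →ₗ[K] H) : Prop :=
  Φ 1 = 1 ∧
  ∀ (n : ℕ) (p : ℕ → Prim K H),
    Φ (Fmap top n (segT p 1 n)) =
      ∑ c : Composition (n + 1),
        nestList' top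
          (List.ofFn fun i : Fin c.length =>
            ((us (c.blocksFun i - 1)
                (segT p ((n + 1) - c.sizeUpTo (i + 1) + 1) (c.blocksFun i - 1)) :
              Prim K H) : H))

/-- `Φ` is a coalgebra endomorphism of `H`. -/
def IsCoalgEndo (Φ : H →ₗ[K] H) : Prop :=
  (TensorProduct.map Φ Φ) ∘ₗ Coalgebra.comul (R := K) = Coalgebra.comul (R := K) ∘ₗ Φ ∧
  Coalgebra.counit (R := K) ∘ₗ Φ = Coalgebra.counit (R := K)

end TensorPowers


section GrowthFiltration

variable {K : Type u} [Field K] {H : Type u} [Ring H] [HopfAlgebra K H]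

theorem rTensor_lTensor_comm {M N P Q : Type*} [AddCommGroup M] [Module K M] [AddCommGroup N]
    [Module K N] [AddCommGroup P] [Module K P] [AddCommGroup Q] [Module K Q]
    (f : M →ₗ[K] N) (g : P →ₗ[K] Q) (w : M ⊗[K] P) :
    f.rTensor Q (g.lTensor M w) = g.lTensor N (f.rTensor P w) := by
  rw [← LinearMap.comp_apply, ← LinearMap.comp_apply, LinearMap.rTensor_comp_lTensor,
    LinearMap.lTensor_comp_rTensor]

theorem reducedComul_apply (x : H) : reducedComul K H x =
    Coalgebra.comul (R := K) x - x ⊗ₜ[K] 1 - 1 ⊗ₜ[K] x := rfl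

theorem reducedComul_coassoc (x : H) :
    TensorProduct.assoc K H H H ((reducedComul K H).rTensor H (reducedComul K H x)) =
      (reducedComul K H).lTensor H (reducedComul K H x) := by
  have hr (w : H ⊗[K] H) : (reducedComul K H).rTensor H w =
      (Coalgebra.comul (R := K)).rTensor H w
        - ((TensorProduct.mk K H H).flip 1).rTensor H w
        - (TensorProduct.mk K H H 1).rTensor H w := by
    simp [reducedComul, LinearMap.rTensor_sub]
  have hl (w : H ⊗[K] H) : (reducedComul K H).lTensor H w =
      (Coalgebra.comul (R := K)).lTensor H w
        - ((TensorProduct.mk K H H).flip 1).lTensor H w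
        - (TensorProduct.mk K H H 1).lTensor H w := by
    simp [reducedComul, LinearMap.lTensor_sub]
  have h1 (w : H ⊗[K] H) :
      TensorProduct.assoc K H H H (((TensorProduct.mk K H H).flip 1).rTensor H w) =
      (TensorProduct.mk K H H 1).lTensor H w := by
    induction w with
    | zero => simp
    | tmul a b => simp
    | add a b ha hb => simp [ha, hb]
  have h2 (w : H ⊗[K] H) :
      TensorProduct.assoc K H H H ((TensorProduct.mk K H H 1).rTensor H w) = 1 ⊗ₜ[K] w := by
    induction w with
    | zero => simp
    | tmul a b => simp
    | add a b ha hb => simp [ha, hb, TensorProduct.tmul_add]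
  have h3 (w : H ⊗[K] H) : TensorProduct.assoc K H H H (w ⊗ₜ[K] 1) =
      ((TensorProduct.mk K H H).flip 1).lTensor H w := by
    induction w with
    | zero => simp
    | tmul a b => simp
    | add a b ha hb => simp [ha, hb, TensorProduct.add_tmul]
  rw [hr, hl]
  simp only [map_sub, h1, h2]
  simp only [reducedComul_apply, map_sub, LinearMap.rTensor_tmul, LinearMap.lTensor_tmul,
    Coalgebra.coassoc_apply, h3, TensorProduct.tmul_sub, Bialgebra.comul_one,
    TensorProduct.mk_apply, LinearMap.flip_apply, TensorProduct.assoc_tmul,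
    Algebra.TensorProduct.one_def]
  abel

theorem counit_rTensor_reducedComul (x : H) :
    (Coalgebra.counit (R := K)).rTensor H (reducedComul K H x) =
      -(Coalgebra.counit (R := K) x ⊗ₜ[K] (1 : H)) := by
  simp [reducedComul_apply]

theorem counit_prim {p : H} (hp : p ∈ Prim K H) : Coalgebra.counit (R := K) p = 0 := by
  have h := counit_rTensor_reducedComul (K := K) p
  rw [show reducedComul K H p = 0 from hp, map_zero] at h
  have h' := congrArg (fun w => Coalgebra.counit (R := K) (TensorProduct.lid K H w)) h
  simpa using h'.symm

theorem counit_top {top : H →ₗ[K] H →ₗ[K] H} (htop : IsNaturalGrowth top) {x p : H}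
    (hx : Coalgebra.counit (R := K) x = 0) (hp : p ∈ Prim K H) :
    Coalgebra.counit (R := K) (top x p) = 0 := by
  have h := counit_rTensor_reducedComul (K := K) (top x p)
  have h1 : (Coalgebra.counit (R := K)).rTensor H
      ((TensorProduct.map LinearMap.id (top.flip p)) (reducedComul K H x)) =
      (top.flip p).lTensor K ((Coalgebra.counit (R := K)).rTensor H (reducedComul K H x)) := by
    exact rTensor_lTensor_comm _ _ _
  rw [htop x p hp, map_add, h1, counit_rTensor_reducedComul, hx] at h
  simp only [LinearMap.rTensor_tmul, hx, TensorProduct.zero_tmul, neg_zero, map_zero,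
    add_zero] at h
  have h' := congrArg (fun w => Coalgebra.counit (R := K) (TensorProduct.lid K H w)) h
  simpa using h'.symm

theorem Fmap_succ_tmul (top : H →ₗ[K] H →ₗ[K] H) (n : ℕ) (t : PTP K H n) (p : Prim K H) :
    Fmap top (n + 1) (t ⊗ₜ[K] p : (PTP K H n : Type u) ⊗[K] Prim K H) =
      top (Fmap top n t) p := rfl

theorem PTP_succ_induction {n : ℕ} {motive : PTP K H (n + 1) → Prop} (zero : motive 0)
    (tmul : ∀ (t : PTP K H n) (p : Prim K H),
      motive (t ⊗ₜ[K] p : (PTP K H n : Type u) ⊗[K] Prim K H))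
    (add : ∀ a b, motive a → motive b → motive (a + b)) (t : PTP K H (n + 1)) : motive t :=
  TensorProduct.induction_on (motive := motive) t zero tmul add

/-- The sum of the images of `F_1, …, F_n`. -/
noncomputable def growthFiltration (top : H →ₗ[K] H →ₗ[K] H) : ℕ → Submodule K H
  | 0 => ⊥
  | n + 1 => growthFiltration top n ⊔ LinearMap.range (Fmap top n)

theorem growthFiltration_mono (top : H →ₗ[K] H →ₗ[K] H) : Monotone (growthFiltration top) :=
  monotone_nat_of_le_succ fun _ => le_sup_left

theorem Fmap_mem_growthFiltration (top : H →ₗ[K] H →ₗ[K] H) {k n : ℕ} (h : k < n)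
    (t : PTP K H k) : Fmap top k t ∈ growthFiltration top n :=
  growthFiltration_mono top h (Submodule.mem_sup_right (LinearMap.mem_range_self _ t))

theorem growthFiltration_le {top : H →ₗ[K] H →ₗ[K] H} {n : ℕ} {S : Submodule K H}
    (h : ∀ k < n, ∀ t, Fmap top k t ∈ S) : growthFiltration top n ≤ S := by
  induction n with
  | zero => exact bot_le
  | succ n ih =>
    refine sup_le (ih fun k hk => h k (by omega)) ?_
    rintro _ ⟨t, rfl⟩
    exact h n (by omega) t

theorem top_mem_growthFiltration (top : H →ₗ[K] H →ₗ[K] H) {n : ℕ} {x : H}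
    (hx : x ∈ growthFiltration top n) (p : Prim K H) :
    top x p ∈ growthFiltration top (n + 1) := by
  have : growthFiltration top n ≤ (growthFiltration top (n + 1)).comap (top.flip p) :=
    growthFiltration_le fun k hk t => by
      rw [Submodule.mem_comap, LinearMap.flip_apply, ← Fmap_succ_tmul]
      exact Fmap_mem_growthFiltration top (by omega) _
  exact this hx

theorem prim_mem_growthFiltration (top : H →ₗ[K] H →ₗ[K] H) (p : Prim K H) :
    (p : H) ∈ growthFiltration top 1 :=
  Fmap_mem_growthFiltration top (k := 0) Nat.one_pos p

theorem counit_Fmap {top : H →ₗ[K] H →ₗ[K] H} (htop : IsNaturalGrowth top) (n : ℕ)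
    (t : PTP K H n) : Coalgebra.counit (R := K) (Fmap top n t) = 0 := by
  induction n with
  | zero => exact counit_prim (Subtype.prop (p := (· ∈ Prim K H)) t)
  | succ n ih =>
    induction t using PTP_succ_induction with
    | zero => simp
    | tmul t p => exact counit_top htop (ih t) p.2
    | add a b ha hb => simp [ha, hb]

theorem counit_growthFiltration {top : H →ₗ[K] H →ₗ[K] H} (htop : IsNaturalGrowth top) {n : ℕ}
    {x : H} (hx : x ∈ growthFiltration top n) : Coalgebra.counit (R := K) x = 0 :=
  growthFiltration_le (S := LinearMap.ker (Coalgebra.counit (R := K)))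
    (fun k _ t => counit_Fmap htop k t) hx

theorem rTensor_mkQ_eq_zero_of_le {A B : Submodule K H} (h : A ≤ B) {M : Type*}
    [AddCommGroup M] [Module K M] {w : H ⊗[K] M}
    (hw : A.mkQ.rTensor M w = 0) : B.mkQ.rTensor M w = 0 := by
  have : B.mkQ = (Submodule.factor h) ∘ₗ A.mkQ := by ext; simp
  rw [this, LinearMap.rTensor_comp_apply, hw, map_zero]

theorem rTensor_mkQ_reducedComul_top {top : H →ₗ[K] H →ₗ[K] H} (htop : IsNaturalGrowth top)
    (A : Submodule K H) (x : H) (p : Prim K H) :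
    A.mkQ.rTensor H (reducedComul K H (top x p)) =
      A.mkQ x ⊗ₜ[K] (p : H) +
        (top.flip p).lTensor (H ⧸ A) (A.mkQ.rTensor H (reducedComul K H x)) := by
  rw [htop x p p.2, map_add, LinearMap.rTensor_tmul]
  exact congrArg _ (rTensor_lTensor_comm _ _ _)

theorem rTensor_mkQ_reducedComul_Fmap {top : H →ₗ[K] H →ₗ[K] H} (htop : IsNaturalGrowth top)
    (n : ℕ) (t : PTP K H n) :
    (growthFiltration top n).mkQ.rTensor H (reducedComul K H (Fmap top n t)) = 0 := by
  induction n with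
  | zero =>
    rw [show reducedComul K H (Fmap top 0 t) = 0 from
      Subtype.prop (p := (· ∈ Prim K H)) t, map_zero]
  | succ n ih =>
    induction t using PTP_succ_induction with
    | zero => simp
    | tmul t p =>
      rw [Fmap_succ_tmul, rTensor_mkQ_reducedComul_top htop,
        rTensor_mkQ_eq_zero_of_le (growthFiltration_mono top n.le_succ) (ih t), map_zero,
        add_zero, Submodule.mkQ_apply, (Submodule.Quotient.mk_eq_zero _).2
          (Fmap_mem_growthFiltration top n.lt_succ_self t), TensorProduct.zero_tmul]
    | add a b ha hb => rw [map_add, map_add, map_add, ha, hb, add_zero]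

theorem rTensor_mkQ_reducedComul_growthFiltration {top : H →ₗ[K] H →ₗ[K] H}
    (htop : IsNaturalGrowth top) {n : ℕ} {x : H} (hx : x ∈ growthFiltration top (n + 1)) :
    (growthFiltration top n).mkQ.rTensor H (reducedComul K H x) = 0 :=
  growthFiltration_le
    (S := LinearMap.ker ((growthFiltration top n).mkQ.rTensor H ∘ₗ reducedComul K H))
    (fun _ hk t => rTensor_mkQ_eq_zero_of_le (growthFiltration_mono top (Nat.le_of_lt_succ hk))
      (rTensor_mkQ_reducedComul_Fmap htop _ t)) hx

/-- The images of the `F_i` are independent, and each `F_i` is injective. -/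
theorem eq_zero_of_Fmap_mem_growthFiltration {top : H →ₗ[K] H →ₗ[K] H}
    (htop : IsNaturalGrowth top) (n : ℕ) (t : PTP K H n)
    (h : Fmap top n t ∈ growthFiltration top n) : t = 0 := by
  induction n with
  | zero => exact Subtype.ext h
  | succ n ih =>
    have hinj : Function.Injective ((growthFiltration top n).mkQ ∘ₗ Fmap top n) := by
      rw [← LinearMap.ker_eq_bot, LinearMap.ker_eq_bot']
      intro s hs
      exact ih s ((Submodule.Quotient.mk_eq_zero _).1 hs)
    have key (s : PTP K H (n + 1)) :
        (growthFiltration top n).mkQ.rTensor H (reducedComul K H (Fmap top (n + 1) s)) =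
        TensorProduct.map ((growthFiltration top n).mkQ ∘ₗ Fmap top n) (Prim K H).subtype
          (s : (PTP K H n : Type u) ⊗[K] Prim K H) := by
      induction s using PTP_succ_induction with
      | zero => rw [map_zero, map_zero, map_zero]; exact (map_zero _).symm
      | tmul t p =>
        rw [Fmap_succ_tmul, rTensor_mkQ_reducedComul_top htop,
          rTensor_mkQ_reducedComul_Fmap htop, map_zero, add_zero]
        rfl
      | add a b ha hb =>
        rw [map_add, map_add, map_add, ha, hb]
        exact (map_add _ _ _).symm
    have h0 := (key t).symm.trans (rTensor_mkQ_reducedComul_growthFiltration htop h)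
    refine (map_eq_zero_iff _ ?_).1 h0
    exact TensorProduct.map_injective_of_flat_flat _ _ hinj (Prim K H).injective_subtype

/-- `Δ̂ x ∈ R ⊗ H` for `R = growthFiltration top n` forces `x` into the next filtration step. -/
theorem mem_growthFiltration_of_rTensor_mkQ {top : H →ₗ[K] H →ₗ[K] H}
    (htop : IsNaturalGrowth top) (n : ℕ) (x : H)
    (h : (growthFiltration top n).mkQ.rTensor H (reducedComul K H x) = 0) :
    x ∈ growthFiltration top (n + 1) := by
  induction n generalizing x with
  | zero =>
    refine prim_mem_growthFiltration top ⟨x, ?_⟩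
    refine (map_eq_zero_iff ((growthFiltration top 0).mkQ.rTensor H) ?_).1 h
    refine Module.Flat.rTensor_preserves_injective_linearMap _ ?_
    rw [← LinearMap.ker_eq_bot, Submodule.ker_mkQ]
    rfl
  | succ n ih =>
    set A := growthFiltration top n
    set B := growthFiltration top (n + 1)
    obtain ⟨π, hπ⟩ := (Prim K H).subtype.exists_leftInverse_of_injective
      (Submodule.ker_subtype _)
    obtain ⟨v, hv⟩ : ∃ v : B ⊗[K] H, B.subtype.rTensor H v = reducedComul K H x :=
      (rTensor_exact H (LinearMap.exact_subtype_mkQ B) B.mkQ_surjective _).1 h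
    have hcoassoc : (A.mkQ.rTensor (H ⊗[K] H))
        ((reducedComul K H).lTensor H (reducedComul K H x)) = 0 := by
      rw [← reducedComul_coassoc, ← hv]
      clear hv
      induction v with
      | zero => simp
      | tmul a b =>
        have hz := rTensor_mkQ_reducedComul_growthFiltration htop a.2
        have hcomm (w : H ⊗[K] H) : A.mkQ.rTensor (H ⊗[K] H)
            (TensorProduct.assoc K H H H (w ⊗ₜ[K] b)) =
            TensorProduct.assoc K _ H H (A.mkQ.rTensor H w ⊗ₜ[K] b) := by
          induction w with
          | zero => simp
          | tmul c d => simp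
          | add c d hc hd => simp only [TensorProduct.add_tmul, map_add, hc, hd]
        rw [LinearMap.rTensor_tmul, LinearMap.rTensor_tmul, hcomm]
        erw [hz]
        simp
      | add a b ha hb => rw [map_add, map_add, map_add, map_add, ha, hb, add_zero]
    have hker : (reducedComul K H).lTensor (H ⧸ A) (A.mkQ.rTensor H (reducedComul K H x)) = 0 := by
      rw [← hcoassoc, rTensor_lTensor_comm]
    have hex : Function.Exact (Prim K H).subtype (reducedComul K H) :=
      LinearMap.exact_subtype_ker_map _
    obtain ⟨q, hq⟩ := (Module.Flat.lTensor_exact (H ⧸ A) hex _).1 hker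
    have hproj : ((Prim K H).subtype ∘ₗ π).lTensor (H ⧸ A)
        (A.mkQ.rTensor H (reducedComul K H x)) = A.mkQ.rTensor H (reducedComul K H x) := by
      rw [← hq, ← LinearMap.comp_apply, ← LinearMap.lTensor_comp, LinearMap.comp_assoc, hπ,
        LinearMap.comp_id]
    have hz (w : B ⊗[K] Prim K H) : ∃ z ∈ growthFiltration top (n + 2),
        A.mkQ.rTensor H (reducedComul K H z) =
          TensorProduct.map (A.mkQ ∘ₗ B.subtype) (Prim K H).subtype w := by
      induction w with
      | zero => exact ⟨0, zero_mem _, by simp⟩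
      | tmul b p =>
        refine ⟨top b p, top_mem_growthFiltration top b.2 p, ?_⟩
        rw [rTensor_mkQ_reducedComul_top htop,
          rTensor_mkQ_reducedComul_growthFiltration htop b.2, map_zero, add_zero]
        rfl
      | add a b ha hb =>
        obtain ⟨y, hy, hy'⟩ := ha
        obtain ⟨z, hz, hz'⟩ := hb
        exact ⟨y + z, add_mem hy hz, by simp only [map_add, hy', hz']⟩
    obtain ⟨z, hzmem, hz⟩ := hz (π.lTensor B v)
    have hsub : x - z ∈ growthFiltration top (n + 1) := by
      refine ih _ ?_
      rw [map_sub, map_sub, hz, ← hproj, ← hv, sub_eq_zero]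
      simp only [LinearMap.rTensor, LinearMap.lTensor, ← LinearMap.comp_apply,
        ← TensorProduct.map_comp, LinearMap.id_comp, LinearMap.comp_id]
    have := add_mem (growthFiltration_mono top (n + 1).le_succ hsub) hzmem
    rwa [sub_add_cancel] at this

/-- The shape of an element of `⨆_{i + j = N} H_i ⊗ H_j`, when `H_i` for `0 < i < N` lies in `R`
and in the kernel of the counit. -/
theorem exists_eq_of_mem_iSup_grade (G : HopfGrading (K := K) (H := H)) {N : ℕ}
    (R : Submodule K H) (hR : ∀ i, 0 < i → i < N → G.grade i ≤ R)
    (hε : ∀ x ∈ R, Coalgebra.counit (R := K) x = 0) {w : H ⊗[K] H}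
    (hw : w ∈ ⨆ p : {p : ℕ × ℕ // p.1 + p.2 = N},
        LinearMap.range (TensorProduct.map (G.grade p.1.1).subtype (G.grade p.1.2).subtype)) :
    ∃ a ∈ G.grade N, ∃ b ∈ G.grade N, ∃ m : H ⊗[K] H, w = 1 ⊗ₜ a + b ⊗ₜ 1 + m ∧
      R.mkQ.rTensor H m = 0 ∧ (Coalgebra.counit (R := K)).rTensor H m = 0 ∧
      (Coalgebra.counit (R := K)).lTensor H m = 0 := by
  have hone {x : H} (hx : x ∈ G.grade 0) : ∃ c : K, c • (1 : H) = x := by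
    rwa [G.connected, Submodule.mem_span_singleton] at hx
  induction hw using Submodule.iSup_induction' with
  | zero => exact ⟨0, zero_mem _, 0, zero_mem _, 0, by simp⟩
  | add x y _ _ hx hy =>
    obtain ⟨a, ha, b, hb, m, rfl, h1, h2, h3⟩ := hx
    obtain ⟨a', ha', b', hb', m', rfl, h1', h2', h3'⟩ := hy
    refine ⟨a + a', add_mem ha ha', b + b', add_mem hb hb', m + m', ?_, ?_, ?_, ?_⟩
    · rw [TensorProduct.tmul_add, TensorProduct.add_tmul]; abel
    · rw [map_add, h1, h1', add_zero]
    · rw [map_add, h2, h2', add_zero]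
    · rw [map_add, h3, h3', add_zero]
  | mem p x hx =>
    obtain ⟨⟨i, j⟩, hij⟩ := p
    dsimp only at hij hx
    obtain ⟨v, rfl⟩ := hx
    induction v with
    | zero => exact ⟨0, zero_mem _, 0, zero_mem _, 0, by simp⟩
    | add x y hx hy =>
      obtain ⟨a, ha, b, hb, m, hm, h1, h2, h3⟩ := hx
      obtain ⟨a', ha', b', hb', m', hm', h1', h2', h3'⟩ := hy
      refine ⟨a + a', add_mem ha ha', b + b', add_mem hb hb', m + m', ?_, ?_, ?_, ?_⟩
      · rw [map_add, hm, hm', TensorProduct.tmul_add, TensorProduct.add_tmul]; abel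
      · rw [map_add, h1, h1', add_zero]
      · rw [map_add, h2, h2', add_zero]
      · rw [map_add, h3, h3', add_zero]
    | tmul x y =>
      obtain ⟨x, hx⟩ := x
      obtain ⟨y, hy⟩ := y
      rw [TensorProduct.map_tmul, Submodule.subtype_apply, Submodule.subtype_apply]
      rcases Nat.eq_zero_or_pos i with rfl | hi
      · obtain ⟨c, rfl⟩ := hone hx
        obtain rfl : j = N := by omega
        exact ⟨c • y, Submodule.smul_mem _ _ hy, 0, zero_mem _, 0,
          by simp [TensorProduct.smul_tmul]⟩
      rcases Nat.eq_zero_or_pos j with rfl | hj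
      · obtain ⟨c, rfl⟩ := hone hy
        obtain rfl : i = N := by omega
        exact ⟨0, zero_mem _, c • x, Submodule.smul_mem _ _ hx, 0,
          by simp [TensorProduct.smul_tmul]⟩
      · have hx := hR i hi (by omega) hx
        have hy := hR j hj (by omega) hy
        refine ⟨0, zero_mem _, 0, zero_mem _, x ⊗ₜ y, by simp, ?_, ?_, ?_⟩
        · rw [LinearMap.rTensor_tmul, Submodule.mkQ_apply, (Submodule.Quotient.mk_eq_zero _).2 hx,
            TensorProduct.zero_tmul]
        · rw [LinearMap.rTensor_tmul, hε x hx, TensorProduct.zero_tmul]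
        · rw [LinearMap.lTensor_tmul, hε y hy, TensorProduct.tmul_zero]

theorem grade_le_growthFiltration (G : HopfGrading (K := K) (H := H))
    {top : H →ₗ[K] H →ₗ[K] H} (htop : IsNaturalGrowth top) (N : ℕ) :
    G.grade (N + 1) ≤ growthFiltration top (N + 1) := by
  induction N using Nat.strong_induction_on with
  | _ N ih =>
  intro x hx
  refine mem_growthFiltration_of_rTensor_mkQ htop N x ?_
  have hR (i : ℕ) (hi : 0 < i) (hiN : i < N + 1) : G.grade i ≤ growthFiltration top N := by
    obtain ⟨i, rfl⟩ : ∃ k, i = k + 1 := ⟨i - 1, by omega⟩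
    exact (ih i (by omega)).trans (growthFiltration_mono top (by omega))
  obtain ⟨a, ha, b, hb, m, hw, h1, h2, h3⟩ := exists_eq_of_mem_iSup_grade G _ hR
    (fun x hx => counit_growthFiltration htop hx) (G.comul_mem (N + 1) x hx)
  have hscalar {y : H} (hy : y ∈ G.grade (N + 1)) {c : K} (h : y = c • (1 : H)) : y = 0 := by
    have hdisj := G.internal.submodule_iSupIndep.pairwiseDisjoint
      (show N + 1 ≠ 0 by omega)
    refine Submodule.disjoint_def.1 hdisj y hy ?_
    rw [G.connected, h]
    exact Submodule.smul_mem _ _ (Submodule.mem_span_singleton_self _)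
  have hxa : x - a = Coalgebra.counit (R := K) b • (1 : H) := by
    have h := congrArg (TensorProduct.lid K H) (Coalgebra.rTensor_counit_comul (R := K) x)
    rw [hw, map_add, map_add, h2] at h
    simp only [LinearMap.rTensor_tmul, Bialgebra.counit_one, map_add, TensorProduct.lid_tmul,
      one_smul, map_zero, add_zero] at h
    rw [← h, add_sub_cancel_left]
  have hxb : x - b = Coalgebra.counit (R := K) a • (1 : H) := by
    have h := congrArg (TensorProduct.rid K H) (Coalgebra.lTensor_counit_comul (R := K) x)
    rw [hw, map_add, map_add, h3] at h
    simp only [LinearMap.lTensor_tmul, Bialgebra.counit_one, map_add, TensorProduct.rid_tmul,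
      one_smul, map_zero, add_zero] at h
    rw [← h, add_sub_cancel_right]
  have hxa' := sub_eq_zero.1 (hscalar (sub_mem hx ha) hxa)
  have hxb' := sub_eq_zero.1 (hscalar (sub_mem hx hb) hxb)
  rw [reducedComul_apply, hw, ← hxa', ← hxb',
    show (1 : H) ⊗ₜ[K] x + x ⊗ₜ[K] (1 : H) + m - x ⊗ₜ[K] 1 - 1 ⊗ₜ[K] x = m by abel, h1]

/-- The span of `1` and the images of `F_1, …, F_n`. -/
noncomputable def unitalFiltration (top : H →ₗ[K] H →ₗ[K] H) (n : ℕ) : Submodule K H :=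
  (K ∙ (1 : H)) ⊔ growthFiltration top n

theorem unitalFiltration_mono (top : H →ₗ[K] H →ₗ[K] H) : Monotone (unitalFiltration top) :=
  fun _ _ h => sup_le_sup_left (growthFiltration_mono top h) _

theorem mem_unitalFiltration {top : H →ₗ[K] H →ₗ[K] H} {n : ℕ} {x : H} :
    x ∈ unitalFiltration top n ↔ ∃ c : K, ∃ r ∈ growthFiltration top n, c • (1 : H) + r = x := by
  simp only [unitalFiltration, Submodule.mem_sup, Submodule.mem_span_singleton]
  constructor
  · rintro ⟨_, ⟨c, rfl⟩, r, hr, h⟩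
    exact ⟨c, r, hr, h⟩
  · rintro ⟨c, r, hr, h⟩
    exact ⟨_, ⟨c, rfl⟩, r, hr, h⟩

theorem mem_unitalFiltration_succ {top : H →ₗ[K] H →ₗ[K] H} {n : ℕ} {x : H}
    (hx : x ∈ unitalFiltration top (n + 1)) :
    ∃ y ∈ unitalFiltration top n, ∃ t, y + Fmap top n t = x := by
  rw [unitalFiltration, growthFiltration, ← sup_assoc] at hx
  obtain ⟨y, hy, _, ⟨t, rfl⟩, h⟩ := Submodule.mem_sup.1 hx
  exact ⟨y, hy, t, h⟩

theorem mem_growthFiltration_of_counit_eq_zero {top : H →ₗ[K] H →ₗ[K] H}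
    (htop : IsNaturalGrowth top) {n : ℕ} {x : H} (hx : x ∈ unitalFiltration top n)
    (h0 : Coalgebra.counit (R := K) x = 0) : x ∈ growthFiltration top n := by
  obtain ⟨c, r, hr, rfl⟩ := mem_unitalFiltration.1 hx
  rw [map_add, counit_growthFiltration htop hr, map_smul, Bialgebra.counit_one, add_zero,
    smul_eq_mul, mul_one] at h0
  rwa [h0, zero_smul, zero_add]

theorem exists_mem_unitalFiltration (G : HopfGrading (K := K) (H := H))
    {top : H →ₗ[K] H →ₗ[K] H} (htop : IsNaturalGrowth top) (x : H) :
    ∃ n, x ∈ unitalFiltration top n := by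
  have hx : x ∈ ⨆ i, G.grade i := by
    rw [G.internal.submodule_iSup_eq_top]; trivial
  rw [← Submodule.mem_iSup_of_directed _ (unitalFiltration_mono top).directed_le]
  suffices h : ⨆ i, G.grade i ≤ ⨆ i, unitalFiltration top i from h hx
  refine iSup_le fun i => le_trans ?_ (le_iSup _ i)
  cases i with
  | zero => exact G.connected.le.trans le_sup_left
  | succ i => exact (grade_le_growthFiltration G htop i).trans le_sup_right

/-- The tensor power `u ⊗ ⋯ ⊗ u` acting on `P(H)^{⊗(n+1)}`. -/
noncomputable def PTPmap (u : (PTP K H 0 : Type u) →ₗ[K] Prim K H) :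
    (n : ℕ) → (PTP K H n : Type u) →ₗ[K] (PTP K H n : Type u)
  | 0 => u
  | n + 1 => TensorProduct.map (PTPmap u n) u

theorem PTPmap_injective {u : (PTP K H 0 : Type u) →ₗ[K] Prim K H} (hu : Function.Injective u) (n : ℕ) :
    Function.Injective (PTPmap u n) := by
  induction n with
  | zero => exact hu
  | succ n ih => exact TensorProduct.map_injective_of_flat_flat _ _ ih hu

theorem PTPmap_surjective {u : (PTP K H 0 : Type u) →ₗ[K] Prim K H} (hu : Function.Surjective u) (n : ℕ) :
    Function.Surjective (PTPmap u n) := by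
  induction n with
  | zero => exact hu
  | succ n ih => exact TensorProduct.map_surjective ih hu

theorem PTPmap_segT (u : (PTP K H 0 : Type u) →ₗ[K] Prim K H) (p : ℕ → Prim K H) (a n : ℕ) :
    PTPmap u n (segT p a n) = segT (fun i => u (p i)) a n := by
  induction n generalizing a with
  | zero => rfl
  | succ n ih =>
    refine Eq.trans (TensorProduct.map_tmul _ _ _ _) ?_
    rw [ih]; rfl

theorem segT_congr {p q : ℕ → Prim K H} {a n : ℕ} (h : ∀ i, a ≤ i → p i = q i) :
    segT p a n = segT q a n := by
  induction n generalizing a with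
  | zero => exact h a le_rfl
  | succ n ih => rw [segT, segT, ih fun i hi => h i (by omega), h a le_rfl]

theorem span_range_segT (a n : ℕ) :
    Submodule.span K (Set.range fun p : ℕ → Prim K H => segT p a n) = ⊤ := by
  induction n generalizing a with
  | zero =>
    rw [eq_top_iff]
    rintro t -
    exact Submodule.subset_span ⟨fun _ => t, rfl⟩
  | succ n ih =>
    rw [eq_top_iff]
    rintro t -
    induction t using PTP_succ_induction with
    | zero => exact zero_mem _
    | add a b ha hb => exact add_mem ha hb
    | tmul t q =>
      have ht : t ∈ Submodule.span K (Set.range fun p : ℕ → Prim K H => segT p (a + 1) n) := by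
        rw [ih]; trivial
      have hle : Submodule.span K (Set.range fun p : ℕ → Prim K H => segT p (a + 1) n) ≤
          (Submodule.span K (Set.range fun p : ℕ → Prim K H => segT p a (n + 1))).comap
            ((TensorProduct.mk K (PTP K H n) (Prim K H)).flip q) := by
        rw [Submodule.span_le]
        rintro _ ⟨p, rfl⟩
        refine Submodule.subset_span ⟨Function.update p a q, ?_⟩
        change segT (Function.update p a q) (a + 1) n ⊗ₜ[K] Function.update p a q a =
          segT p (a + 1) n ⊗ₜ[K] q
        rw [Function.update_self, segT_congr fun i hi =>
          Function.update_of_ne (show i ≠ a by omega) q p]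
      exact hle ht

theorem nestList_append_singleton (top : H →ₗ[K] H →ₗ[K] H) (x y : H) (l : List H) :
    nestList top x (l ++ [y]) = top (nestList top x l) y := by
  induction l generalizing x with
  | nil => rfl
  | cons z l ih => exact ih _

theorem nestList'_append_singleton (top : H →ₗ[K] H →ₗ[K] H) {l : List H} (hl : l ≠ []) (y : H) :
    nestList' top (l ++ [y]) = top (nestList' top l) y := by
  cases l with
  | nil => exact absurd rfl hl
  | cons x l => exact nestList_append_singleton top x y l

theorem nestList'_ofFn (top : H →ₗ[K] H →ₗ[K] H) (n a : ℕ) (q : ℕ → Prim K H) :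
    nestList' top (List.ofFn fun i : Fin (n + 1) => (q (a + n - i) : H)) =
      Fmap top n (segT q a n) := by
  induction n generalizing a with
  | zero => rfl
  | succ n ih =>
    have h : Fmap top (n + 1) (segT q a (n + 1)) = top (Fmap top n (segT q (a + 1) n)) (q a) := rfl
    rw [h, ← ih, List.ofFn_succ', List.concat_eq_append, nestList'_append_singleton]
    · simp [Nat.add_assoc, Nat.add_comm 1 n]
    · simp

theorem nestList'_mem_growthFiltration (top : H →ₗ[K] H →ₗ[K] H) (k : ℕ)
    (f : Fin k → Prim K H) :
    nestList' top (List.ofFn fun i => (f i : H)) ∈ growthFiltration top k := by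
  induction k with
  | zero => exact zero_mem _
  | succ k ih =>
    rw [List.ofFn_succ', List.concat_eq_append]
    cases k with
    | zero => exact prim_mem_growthFiltration top _
    | succ k =>
      rw [nestList'_append_singleton _ (by simp)]
      exact top_mem_growthFiltration top (ih fun i => f i.castSucc) _

/-- `Φ` is triangular with respect to the filtration, with diagonal blocks `u_1 ⊗ ⋯ ⊗ u_1`. -/
theorem PhiEqns.map_Fmap_sub_mem {top : H →ₗ[K] H →ₗ[K] H}
    {us : (m : ℕ) → (PTP K H m : Type u) →ₗ[K] Prim K H} {Φ : H →ₗ[K] H}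
    (hΦ : PhiEqns top us Φ) (n : ℕ) (t : PTP K H n) :
    Φ (Fmap top n t) - Fmap top n (PTPmap (us 0) n t) ∈ growthFiltration top n := by
  have ht : t ∈ Submodule.span K (Set.range fun p : ℕ → Prim K H => segT p 1 n) := by
    rw [span_range_segT]; trivial
  suffices h : Submodule.span K (Set.range fun p : ℕ → Prim K H => segT p 1 n) ≤
      (growthFiltration top n).comap
        (Φ ∘ₗ Fmap top n - Fmap top n ∘ₗ PTPmap (us 0) n) from h ht
  rw [Submodule.span_le]
  rintro _ ⟨p, rfl⟩
  change Φ (Fmap top n (segT p 1 n)) - Fmap top n (PTPmap (us 0) n (segT p 1 n)) ∈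
    growthFiltration top n
  rw [hΦ.2, PTPmap_segT, ← nestList'_ofFn,
    ← Finset.add_sum_erase _ _ (Finset.mem_univ (Composition.ones (n + 1)))]
  have hones : nestList' top (List.ofFn fun i : Fin (Composition.ones (n + 1)).length =>
      ((us ((Composition.ones (n + 1)).blocksFun i - 1)
        (segT p ((n + 1) - (Composition.ones (n + 1)).sizeUpTo (i + 1) + 1)
          ((Composition.ones (n + 1)).blocksFun i - 1)) : Prim K H) : H)) =
      nestList' top (List.ofFn fun i : Fin (n + 1) => ((us 0 (p (1 + n - i)) : Prim K H) : H)) := by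
    congr 1
    refine List.ext_getElem (by simp) fun i h1 h2 => ?_
    have hi : i < n + 1 := by simpa using h2
    simp only [List.getElem_ofFn, Composition.ones_sizeUpTo]
    rw [show n + 1 - min (i + 1) (n + 1) + 1 = 1 + n - i by omega]
    have hus (m a : ℕ) (hm : m = 0) :
        ((us m (segT p a m) : Prim K H) : H) = (us 0 (p a) : Prim K H) := by
      subst hm; rfl
    exact hus _ _ (by rw [Composition.ones_blocksFun])
  rw [hones, add_sub_cancel_left]
  refine Submodule.sum_mem _ fun c hc => ?_
  have hlen : c.length ≤ n := by
    have h1 := c.length_le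
    have h2 : c.length ≠ n + 1 := fun h =>
      (Finset.mem_erase.1 hc).1 (Composition.eq_ones_iff_length.2 h)
    omega
  exact growthFiltration_mono top hlen (nestList'_mem_growthFiltration top _ _)

theorem PhiEqns.map_prim {top : H →ₗ[K] H →ₗ[K] H}
    {us : (m : ℕ) → (PTP K H m : Type u) →ₗ[K] Prim K H} {Φ : H →ₗ[K] H}
    (hΦ : PhiEqns top us Φ) (p : Prim K H) : Φ p = (us 0 p : Prim K H) :=
  sub_eq_zero.1 ((Submodule.mem_bot K).1 (hΦ.map_Fmap_sub_mem 0 p))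

theorem PhiEqns.map_mem_unitalFiltration {top : H →ₗ[K] H →ₗ[K] H}
    {us : (m : ℕ) → (PTP K H m : Type u) →ₗ[K] Prim K H} {Φ : H →ₗ[K] H}
    (hΦ : PhiEqns top us Φ) {n : ℕ} {x : H} (hx : x ∈ unitalFiltration top n) :
    Φ x ∈ unitalFiltration top n := by
  suffices h : unitalFiltration top n ≤ (unitalFiltration top n).comap Φ from h hx
  refine sup_le ?_ (growthFiltration_le fun k hk t => ?_)
  · rw [Submodule.span_singleton_le_iff_mem, Submodule.mem_comap, hΦ.1]
    exact Submodule.mem_sup_left (Submodule.mem_span_singleton_self _)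
  · rw [Submodule.mem_comap, ← sub_add_cancel (Φ (Fmap top k t))]
    exact Submodule.mem_sup_right (add_mem
      (growthFiltration_mono top hk.le (hΦ.map_Fmap_sub_mem k t))
      (Fmap_mem_growthFiltration top hk _))

theorem PhiEqns.mem_unitalFiltration_of_map_mem {top : H →ₗ[K] H →ₗ[K] H}
    (htop : IsNaturalGrowth top)
    {us : (m : ℕ) → (PTP K H m : Type u) →ₗ[K] Prim K H} {Φ : H →ₗ[K] H}
    (hΦ : PhiEqns top us Φ) (hu : Function.Injective (us 0)) {m n : ℕ} {x : H}
    (hx : x ∈ unitalFiltration top n) (hΦx : Φ x ∈ unitalFiltration top m) :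
    x ∈ unitalFiltration top m := by
  induction n generalizing x with
  | zero => exact unitalFiltration_mono top m.zero_le hx
  | succ n ih =>
    rcases Nat.lt_or_ge n m with hnm | hmn
    · exact unitalFiltration_mono top hnm hx
    obtain ⟨y, hy, t, rfl⟩ := mem_unitalFiltration_succ hx
    have hF : Fmap top n (PTPmap (us 0) n t) ∈ unitalFiltration top n := by
      have h := sub_mem (sub_mem (unitalFiltration_mono top hmn hΦx)
        (hΦ.map_mem_unitalFiltration hy))
        (Submodule.mem_sup_right (hΦ.map_Fmap_sub_mem n t))
      rwa [map_add, add_sub_cancel_left, sub_sub_cancel] at h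
    have ht := eq_zero_of_Fmap_mem_growthFiltration htop n _
      (mem_growthFiltration_of_counit_eq_zero htop hF (counit_Fmap htop n _))
    rw [map_eq_zero_iff _ (PTPmap_injective hu n)] at ht
    rw [ht, map_zero, add_zero] at hΦx ⊢
    exact ih hy hΦx

theorem PhiEqns.unitalFiltration_le_range {top : H →ₗ[K] H →ₗ[K] H}
    {us : (m : ℕ) → (PTP K H m : Type u) →ₗ[K] Prim K H} {Φ : H →ₗ[K] H}
    (hΦ : PhiEqns top us Φ) (hu : Function.Surjective (us 0)) (n : ℕ) :
    unitalFiltration top n ≤ LinearMap.range Φ := by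
  induction n with
  | zero =>
    refine sup_le ?_ bot_le
    rw [Submodule.span_singleton_le_iff_mem]
    exact ⟨1, hΦ.1⟩
  | succ n ih =>
    intro x hx
    obtain ⟨y, hy, t, rfl⟩ := mem_unitalFiltration_succ hx
    obtain ⟨s, rfl⟩ := PTPmap_surjective hu n t
    refine add_mem (ih hy) ?_
    have h := sub_mem (LinearMap.mem_range_self Φ (Fmap top n s))
      (ih (Submodule.mem_sup_right (hΦ.map_Fmap_sub_mem n s)))
    rwa [sub_sub_cancel] at h

end GrowthFiltration

theorem coalgebra_endomorphism_bijective_iff {K : Type u} [Field K] [CharZero K]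
    {H : Type u} [Ring H] [HopfAlgebra K H]
    (G : HopfGrading (K := K) (H := H))
    (top : H →ₗ[K] H →ₗ[K] H) (htop : IsNaturalGrowth top)
    (us : (m : ℕ) → (PTP K H m : Type u) →ₗ[K] Prim K H)
    (Φ : H →ₗ[K] H) (hΦ : PhiEqns top us Φ) :
    Function.Bijective Φ ↔ Function.Bijective (us 0) := by
  constructor
  · rintro ⟨hinj, hsurj⟩
    have hu : Function.Injective (us 0) := fun p q hpq => Subtype.ext <| hinj <| by
      refine (hΦ.map_prim p).trans (Eq.trans ?_ (hΦ.map_prim q).symm)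
      exact congrArg _ hpq
    refine ⟨hu, fun p => ?_⟩
    obtain ⟨x, hx⟩ := hsurj p
    obtain ⟨n, hn⟩ := exists_mem_unitalFiltration G htop x
    have hx1 : x ∈ unitalFiltration top 1 := by
      refine hΦ.mem_unitalFiltration_of_map_mem htop hu hn ?_
      rw [hx]
      exact Submodule.mem_sup_right (prim_mem_growthFiltration top p)
    obtain ⟨y, hy, q, rfl⟩ := mem_unitalFiltration_succ hx1
    obtain ⟨c, r, hr, rfl⟩ := mem_unitalFiltration.1 hy
    obtain rfl : r = 0 := hr
    rw [add_zero, map_add, map_smul, hΦ.1] at hx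
    have hq : Φ (Fmap top 0 q) = (us 0 q : Prim K H) := hΦ.map_prim q
    rw [hq] at hx
    have hc := congrArg (Coalgebra.counit (R := K)) hx
    rw [map_add, map_smul, Bialgebra.counit_one, counit_prim (us 0 q).2, counit_prim p.2,
      add_zero, smul_eq_mul, mul_one] at hc
    rw [hc, zero_smul, zero_add] at hx
    exact ⟨q, Subtype.ext hx⟩
  · rintro ⟨hinj, hsurj⟩
    refine ⟨(injective_iff_map_eq_zero Φ).2 fun x hx => ?_, fun x => ?_⟩
    · obtain ⟨n, hn⟩ := exists_mem_unitalFiltration G htop x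
      have h0 : x ∈ unitalFiltration top 0 :=
        hΦ.mem_unitalFiltration_of_map_mem htop hinj hn (by rw [hx]; exact zero_mem _)
      obtain ⟨c, r, hr, rfl⟩ := mem_unitalFiltration.1 h0
      obtain rfl : r = 0 := hr
      rw [add_zero] at hx ⊢
      rwa [map_smul, hΦ.1] at hx
    · obtain ⟨n, hn⟩ := exists_mem_unitalFiltration G htop x
      exact hΦ.unitalFiltration_le_range hsurj n hn
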